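/- The set FullL is a minimum-size suffixient set for T: FullL is suffixient for T, and every set F ⊆ {1,…,n} that is suffixient for T satisfies |F| ≥ |FullL|. -/

import Mathlib

open scoped Classical

/-- `seg T i len` is the string `T[i..i+len-1]`. -/
def seg (T : ℕ → ℤ) (i len : ℕ) : List ℤ :=
  (List.range len).map fun k => T (i + k)

/-- `sfx T n p` is the suffix `T[p..n]` of a length-`n` text. -/
def sfx (T : ℕ → ℤ) (n p : ℕ) : List ℤ := seg T p (n + 1 - p)

/-- The reversed text: `Trev T n n = T n` and `Trev T n i = T (n - i)` for `i < n`. -/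
def Trev (T : ℕ → ℤ) (n : ℕ) : ℕ → ℤ := fun i => if i = n then T n else T (n - i)

/-- Length of the longest common prefix of two strings. -/
def lcpLen : List ℤ → List ℤ → ℕ
  | a :: l₁, b :: l₂ => if a = b then lcpLen l₁ l₂ + 1 else 0
  | _, _ => 0

/-- `s` occurs as a substring of `T[1..n]`. -/
def OccursIn (T : ℕ → ℤ) (n : ℕ) (s : List ℤ) : Prop :=
  ∃ i : ℕ, 1 ≤ i ∧ i + s.length ≤ n + 1 ∧ s = seg T i s.length

/-- `s` is a right-maximal substring of `T[1..n]` over the alphabet `{1,…,σ}`. -/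
def RightMax (T : ℕ → ℤ) (n σ : ℕ) (s : List ℤ) : Prop :=
  ∃ a b : ℤ, a ≠ b ∧ 1 ≤ a ∧ a ≤ (σ : ℤ) ∧ 1 ≤ b ∧ b ≤ (σ : ℤ) ∧
    OccursIn T n (s ++ [a]) ∧ OccursIn T n (s ++ [b])

/-- `X` is a suffixient set for `T[1..n]`. -/
def Suffixient (T : ℕ → ℤ) (n σ : ℕ) (X : Set ℕ) : Prop :=
  ∀ s : List ℤ, RightMax T n σ s → ∀ c : ℤ, 1 ≤ c → c ≤ (σ : ℤ) →
    OccursIn T n (s ++ [c]) → ∃ x ∈ X, (s ++ [c]) <:+ seg T 1 x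

def StartRun (BWT : ℕ → ℤ) (x : ℕ) : Prop := 1 < x ∧ BWT x ≠ BWT (x - 1)

def EndRun (BWT : ℕ → ℤ) (n x : ℕ) : Prop := x < n ∧ BWT x ≠ BWT (x + 1)

def RunBoundary (BWT : ℕ → ℤ) (n x : ℕ) : Prop := StartRun BWT x ∨ EndRun BWT n x

/-- `bIdx L x` : the largest index `y < x` with `L y < L x`, or `1` if none exists. -/
noncomputable def bIdx (L : ℕ → ℤ) (x : ℕ) : ℕ :=
  sSup {y : ℕ | (1 ≤ y ∧ y < x ∧ L y < L x) ∨ y = 1}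

/-- `eIdx L n x` : the smallest index `y > x` with `L y < L x`, or `n+1` if none exists. -/
noncomputable def eIdx (L : ℕ → ℤ) (n x : ℕ) : ℕ :=
  sInf {y : ℕ | (x < y ∧ y ≤ n ∧ L y < L x) ∨ y = n + 1}

/-- The maximal weight `w y` over indices `a ≤ y < a'` with `BWT y = c` and `w y ≥ 0`. -/
noncomputable def wMax (BWT w : ℕ → ℤ) (c : ℤ) (a a' : ℕ) : ℤ :=
  (sSup {m : ℕ | ∃ q : ℕ, a ≤ q ∧ q < a' ∧ BWT q = c ∧ 0 ≤ w q ∧ (m : ℤ) = w q} : ℕ)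

/-- `Candt BWT w c a a'`: the smallest index `a ≤ p < a'` with `BWT p = c` whose weight
attains the maximum weight among such indices; `-1` if no index
`a ≤ y < a'` with `BWT y = c` and `w y ≥ 0` exists. -/
noncomputable def Candt (BWT w : ℕ → ℤ) (c : ℤ) (a a' : ℕ) : ℤ :=
  if ∃ p : ℕ, a ≤ p ∧ p < a' ∧ BWT p = c ∧ 0 ≤ w p then
    ((sInf {p : ℕ | a ≤ p ∧ p < a' ∧ BWT p = c ∧ w p = wMax BWT w c a a'} : ℕ) : ℤ)
  else -1

def FullL (n : ℕ) (SA : ℕ → ℕ) (BWT LCP w : ℕ → ℤ) : Set ℕ :=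
  { q | ∃ x : ℕ, 1 < x ∧ x ≤ n ∧ BWT x ≠ BWT (x - 1) ∧
      ∃ c : ℤ, (c = BWT x ∨ c = BWT (x - 1)) ∧
      ∃ p : ℕ, (p : ℤ) = Candt BWT w c (bIdx LCP x) (eIdx LCP n x) ∧
        q = n - SA p + 1 }

/-- Basic assumptions on the text `T[1..n]` over alphabet `{1,…,σ}` with sentinel `dollar`. -/
structure TextSetup (n σ : ℕ) (T : ℕ → ℤ) (dollar : ℤ) : Prop where
  hn : 2 ≤ n
  hsigma : 2 ≤ σ
  hsigma_le : σ ≤ n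
  hT : ∀ i, 1 ≤ i → i ≤ n → 1 ≤ T i ∧ T i ≤ (σ : ℤ)
  hTn : T n = dollar
  hTne : ∀ i, 1 ≤ i → i < n → T i ≠ dollar

/-- `SA[1..n]` is the suffix array of the reversed text. -/
structure SASetup (n σ : ℕ) (T : ℕ → ℤ) (dollar : ℤ) (SA : ℕ → ℕ)
    extends TextSetup n σ T dollar : Prop where
  hSAmem : ∀ i, 1 ≤ i → i ≤ n → 1 ≤ SA i ∧ SA i ≤ n
  hSAinj : ∀ i j, 1 ≤ i → i ≤ n → 1 ≤ j → j ≤ n → SA i = SA j → i = j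
  hSAsurj : ∀ p, 1 ≤ p → p ≤ n → ∃ i, 1 ≤ i ∧ i ≤ n ∧ SA i = p
  hSAord : ∀ i j, 1 ≤ i → i < j → j ≤ n →
    List.Lex (· < ·) (sfx (Trev T n) n (SA i)) (sfx (Trev T n) n (SA j))

/-- `LCP[1..n]` is the LCP array of the reversed text. -/
structure LCPSetup (n σ : ℕ) (T : ℕ → ℤ) (dollar : ℤ) (SA : ℕ → ℕ) (LCP : ℕ → ℤ)
    extends SASetup n σ T dollar SA : Prop where
  hLCP1 : LCP 1 = -1
  hLCP : ∀ i, 1 < i → i ≤ n →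
    LCP i = (lcpLen (sfx (Trev T n) n (SA (i - 1))) (sfx (Trev T n) n (SA i)) : ℤ)
  hLCPend : LCP (n + 1) = -1

/-- Additionally, `BWT[1..n]` is the BWT of the reversed text and `w` is the weight function. -/
structure FullSetup (n σ : ℕ) (T : ℕ → ℤ) (dollar : ℤ) (SA : ℕ → ℕ)
    (BWT LCP w : ℕ → ℤ) extends LCPSetup n σ T dollar SA LCP : Prop where
  hBWT : ∀ i, 1 ≤ i → i ≤ n → BWT i = T (n - SA i + 1)
  hBWTend : BWT (n + 1) = -1
  hwNot : ∀ x, 1 ≤ x → x ≤ n → ¬ RunBoundary BWT n x → w x = -1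
  hwRB : ∀ x, 1 ≤ x → x ≤ n → RunBoundary BWT n x →
    (∃ s : List ℤ, RightMax T n σ s ∧ s <:+ seg T 1 (n - SA x)) →
    IsGreatest {m : ℤ | ∃ s : List ℤ, RightMax T n σ s ∧ s <:+ seg T 1 (n - SA x) ∧
      m = (s.length : ℤ)} (w x)

/-- `sIdx`: the minimum index `i ∈ [1..n]` such that `T[n-SA[ℓ]+1-w(ℓ)..n-SA[ℓ]]`
is a suffix of `T[1..n-SA[i]]`. -/
noncomputable def sIdx (T : ℕ → ℤ) (n : ℕ) (SA : ℕ → ℕ) (w : ℕ → ℤ) (l : ℕ) : ℕ :=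
  sInf {i : ℕ | 1 ≤ i ∧ i ≤ n ∧
    seg T (n - SA l + 1 - (w l).toNat) (w l).toNat <:+ seg T 1 (n - SA i)}

/-- `tIdx`: the maximum such index. -/
noncomputable def tIdx (T : ℕ → ℤ) (n : ℕ) (SA : ℕ → ℕ) (w : ℕ → ℤ) (l : ℕ) : ℕ :=
  sSup {i : ℕ | 1 ≤ i ∧ i ≤ n ∧
    seg T (n - SA l + 1 - (w l).toNat) (w l).toNat <:+ seg T 1 (n - SA i)}

/-- `pIdx c i`: the largest index `j < i` with `w j > -1` and `BWT j = c`, or `0`. -/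
noncomputable def pIdx (BWT w : ℕ → ℤ) (c : ℤ) (i : ℕ) : ℕ :=
  sSup {j : ℕ | (1 ≤ j ∧ j < i ∧ -1 < w j ∧ BWT j = c) ∨ j = 0}

/-- `pW c i`: the weight of `pIdx c i`, or `-1` if no index as in `pIdx` exists. -/
noncomputable def pW (BWT w : ℕ → ℤ) (c : ℤ) (i : ℕ) : ℤ :=
  if ∃ j : ℕ, 1 ≤ j ∧ j < i ∧ -1 < w j ∧ BWT j = c then w (pIdx BWT w c i) else -1

/-- `α` is colexicographically smaller than `β`. -/
def ColexLt (α β : List ℤ) : Prop :=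
  (α ≠ β ∧ α <:+ β) ∨
  ∃ k : ℕ, 1 ≤ k ∧ k ≤ α.length ∧ k ≤ β.length ∧
    (∀ i, 1 ≤ i → i < k → α.getD (α.length - i) 0 = β.getD (β.length - i) 0) ∧
    α.getD (α.length - k) 0 < β.getD (β.length - k) 0

section Strings

theorem seg_length (T : ℕ → ℤ) (i len : ℕ) : (seg T i len).length = len := by simp [seg]

theorem seg_add (T : ℕ → ℤ) (i a b : ℕ) : seg T i (a + b) = seg T i a ++ seg T (i + a) b := by
  simp [seg, List.range_add, Function.comp_def, add_assoc]

theorem seg_succ (T : ℕ → ℤ) (i a : ℕ) : seg T i (a + 1) = seg T i a ++ [T (i + a)] := by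
  simp [seg, List.range_succ]

theorem mem_seg {T : ℕ → ℤ} {i len : ℕ} {c : ℤ} :
    c ∈ seg T i len ↔ ∃ k < len, T (i + k) = c := by
  simp [seg]

theorem suffix_seg_iff {T : ℕ → ℤ} {m : ℕ} {s : List ℤ} :
    s <:+ seg T 1 m ↔ ∃ k, k + s.length = m ∧ s = seg T (1 + k) s.length := by
  constructor
  · intro h
    have hle := h.length_le
    rw [seg_length] at hle
    obtain ⟨k, rfl⟩ := Nat.exists_eq_add_of_le' hle
    refine ⟨k, rfl, ?_⟩
    rw [seg_add] at h
    exact (List.suffix_of_suffix_length_le h (List.suffix_append _ _)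
      (by rw [seg_length])).eq_of_length (by rw [seg_length])
  · rintro ⟨k, rfl, hs⟩
    rw [seg_add, ← hs]
    exact List.suffix_append _ _

theorem concat_suffix_concat_iff {s t : List ℤ} {c d : ℤ} :
    s ++ [c] <:+ t ++ [d] ↔ s <:+ t ∧ c = d := by
  rw [List.suffix_concat_iff]
  constructor
  · rintro (h | ⟨u, hu, hut⟩)
    · simp at h
    · obtain ⟨rfl, h⟩ := List.append_inj' hu rfl
      exact ⟨hut, by simpa using h⟩
  · rintro ⟨h, rfl⟩
    exact Or.inr ⟨s, rfl, h⟩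

/-- Strings with a given prefix are contiguous in the lexicographic order. -/
theorem prefix_of_lex_between {r a b c : List ℤ} (hab : List.Lex (· < ·) a b)
    (hbc : List.Lex (· < ·) b c) (hra : r <+: a) (hrc : r <+: c) : r <+: b := by
  induction r generalizing a b c with
  | nil => exact List.nil_prefix
  | cons x r ih =>
    obtain ⟨a', rfl⟩ := hra
    obtain ⟨c', rfl⟩ := hrc
    simp only [List.cons_append] at hab hbc
    cases hab with
    | rel h =>
      cases hbc with
      | rel h' => exact absurd h (by omega)
      | cons h' => exact absurd h (lt_irrefl _)
    | cons h =>
      cases hbc with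
      | rel h' => exact absurd h' (lt_irrefl _)
      | cons h' =>
        exact List.prefix_cons_inj _ |>.2 (ih h h' (List.prefix_append _ _) (List.prefix_append _ _))

theorem length_le_lcpLen {r a b : List ℤ} (hra : r <+: a) (hrb : r <+: b) :
    r.length ≤ lcpLen a b := by
  induction r generalizing a b with
  | nil => simp
  | cons x r ih =>
    obtain ⟨a', rfl⟩ := hra
    obtain ⟨b', rfl⟩ := hrb
    simpa [lcpLen] using ih (List.prefix_append _ a') (List.prefix_append _ b')

theorem prefix_iff_of_length_le_lcpLen {r a b : List ℤ} (h : r.length ≤ lcpLen a b) :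
    r <+: a ↔ r <+: b := by
  induction r generalizing a b with
  | nil => simp
  | cons x r ih =>
    match a, b with
    | [], _ => simp [lcpLen] at h
    | _ :: _, [] => simp [lcpLen] at h
    | y :: a, z :: b =>
      by_cases hyz : y = z
      · subst hyz
        simp only [lcpLen, if_true, List.length_cons, Nat.add_le_add_iff_right] at h
        simp [List.cons_prefix_cons, ih h]
      · simp [lcpLen, hyz] at h

theorem lcpLen_le_length_right (a b : List ℤ) : lcpLen a b ≤ b.length := by
  induction a generalizing b with
  | nil => simp [lcpLen]
  | cons y a ih =>
    match b with
    | [] => simp [lcpLen]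
    | z :: b =>
      have := ih b
      simp only [lcpLen, List.length_cons]
      split <;> omega

theorem prefix_of_prefix_concat {r a b : List ℤ} {d : ℤ} (hab : a ≠ b) (hd : d ∉ b)
    (hra : r <+: a ++ [d]) (hrb : r <+: b ++ [d]) : r <+: a := by
  rcases List.prefix_concat_iff.1 hra with rfl | h
  · rcases List.prefix_concat_iff.1 hrb with h | h
    · exact absurd (List.append_cancel_right h) hab
    · exact absurd (h.subset (by simp)) hd
  · exact h

end Strings

section Indices

theorem exists_adjacent_change {f : ℕ → Prop} {i j : ℕ} (hij : i < j) (hfi : f i) (hfj : ¬ f j) :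
    ∃ x, i < x ∧ x ≤ j ∧ f (x - 1) ∧ ¬ f x := by
  induction j, hij using Nat.le_induction with
  | base => exact ⟨i + 1, by omega, by omega, by simpa using hfi, hfj⟩
  | succ j hj ih =>
    by_cases h : f j
    · exact ⟨j + 1, by omega, le_rfl, by simpa using h, hfj⟩
    · obtain ⟨x, h1, h2, h3⟩ := ih h
      exact ⟨x, h1, by omega, h3⟩

theorem bIdx_spec {L : ℕ → ℤ} {x : ℕ} (hx : 1 < x) :
    1 ≤ bIdx L x ∧ bIdx L x < x ∧ (bIdx L x = 1 ∨ L (bIdx L x) < L x) ∧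
      ∀ y, bIdx L x < y → y < x → L x ≤ L y := by
  have hbdd : BddAbove {y : ℕ | (1 ≤ y ∧ y < x ∧ L y < L x) ∨ y = 1} := ⟨x, by
    rintro y (h | h) <;> omega⟩
  have hmem : bIdx L x ∈ {y : ℕ | (1 ≤ y ∧ y < x ∧ L y < L x) ∨ y = 1} :=
    Nat.sSup_mem ⟨1, Or.inr rfl⟩ hbdd
  have hb : (1 ≤ bIdx L x ∧ bIdx L x < x ∧ L (bIdx L x) < L x) ∨ bIdx L x = 1 := hmem
  refine ⟨by omega, by omega, by tauto, fun y hy hyx => ?_⟩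
  by_contra hlt
  have : y ≤ bIdx L x := le_csSup hbdd (Or.inl ⟨by omega, hyx, by omega⟩)
  omega

theorem eIdx_spec {L : ℕ → ℤ} {n x : ℕ} (hx : x ≤ n) :
    x < eIdx L n x ∧ eIdx L n x ≤ n + 1 ∧ (eIdx L n x = n + 1 ∨ L (eIdx L n x) < L x) ∧
      ∀ y, x < y → y < eIdx L n x → L x ≤ L y := by
  have hmem : eIdx L n x ∈ {y : ℕ | (x < y ∧ y ≤ n ∧ L y < L x) ∨ y = n + 1} :=
    Nat.sInf_mem ⟨n + 1, Or.inr rfl⟩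
  have he : (x < eIdx L n x ∧ eIdx L n x ≤ n ∧ L (eIdx L n x) < L x) ∨ eIdx L n x = n + 1 := hmem
  refine ⟨by omega, by omega, by tauto, fun y hxy hy => ?_⟩
  by_contra hlt
  have : eIdx L n x ≤ y := Nat.sInf_le (Or.inl ⟨hxy, by omega, by omega⟩)
  omega

theorem le_wMax {BWT w : ℕ → ℤ} {c : ℤ} {a a' q : ℕ} (haq : a ≤ q) (hqa : q < a')
    (hc : BWT q = c) (hq : 0 ≤ w q) : w q ≤ wMax BWT w c a a' ∧
      ∃ p, a ≤ p ∧ p < a' ∧ BWT p = c ∧ w p = wMax BWT w c a a' := by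
  set S := {m : ℕ | ∃ q : ℕ, a ≤ q ∧ q < a' ∧ BWT q = c ∧ 0 ≤ w q ∧ (m : ℤ) = w q}
  have hbdd : BddAbove S := by
    refine ((Set.finite_Ico a a').image fun q => (w q).toNat).bddAbove.mono ?_
    rintro m ⟨q, h1, h2, -, -, h3⟩
    exact ⟨q, ⟨h1, h2⟩, by simp [← h3]⟩
  have hmem : (w q).toNat ∈ S := ⟨q, haq, hqa, hc, hq, by omega⟩
  have hle : (w q).toNat ≤ sSup S := le_csSup hbdd hmem
  obtain ⟨p, h1, h2, h3, -, h4⟩ : sSup S ∈ S := Nat.sSup_mem ⟨_, hmem⟩ hbdd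
  refine ⟨?_, p, h1, h2, h3, h4.symm⟩
  change w q ≤ ((sSup S : ℕ) : ℤ)
  omega

theorem exists_eq_candt {BWT w : ℕ → ℤ} {c : ℤ} {a a' q : ℕ} (haq : a ≤ q) (hqa : q < a')
    (hc : BWT q = c) (hq : 0 ≤ w q) : ∃ p : ℕ, (p : ℤ) = Candt BWT w c a a' := by
  rw [Candt, if_pos ⟨q, haq, hqa, hc, hq⟩]
  exact ⟨_, rfl⟩

theorem candt_spec {BWT w : ℕ → ℤ} {c : ℤ} {a a' p : ℕ} (hp : (p : ℤ) = Candt BWT w c a a') :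
    a ≤ p ∧ p < a' ∧ BWT p = c ∧ 0 ≤ w p ∧
      ∀ q, a ≤ q → q < a' → BWT q = c → w q ≤ w p ∧ (w q = w p → p ≤ q) := by
  by_cases h : ∃ q : ℕ, a ≤ q ∧ q < a' ∧ BWT q = c ∧ 0 ≤ w q
  · rw [Candt, if_pos h, Nat.cast_inj] at hp
    obtain ⟨q, h1, h2, h3, h4⟩ := h
    have hmem := Nat.sInf_mem (le_wMax h1 h2 h3 h4).2
    change sInf {p : ℕ | a ≤ p ∧ p < a' ∧ BWT p = c ∧ w p = wMax BWT w c a a'} ∈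
      {p : ℕ | a ≤ p ∧ p < a' ∧ BWT p = c ∧ w p = wMax BWT w c a a'} at hmem
    rw [← hp] at hmem
    obtain ⟨k1, k2, k3, k4⟩ := hmem
    have hle := (le_wMax h1 h2 h3 h4).1
    refine ⟨k1, k2, k3, by omega, fun y y1 y2 y3 => ⟨?_, fun hy => ?_⟩⟩
    · by_cases hy : 0 ≤ w y
      · have := (le_wMax y1 y2 y3 hy).1
        omega
      · omega
    · rw [hp]
      exact Nat.sInf_le ⟨y1, y2, y3, by omega⟩
  · rw [Candt, if_neg h] at hp
    omega

end Indices

section SuffixArray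

variable {n σ : ℕ} {T : ℕ → ℤ} {dollar : ℤ} {SA : ℕ → ℕ} {BWT LCP w : ℕ → ℤ}

theorem sfx_Trev {p : ℕ} (hp : p ≤ n) :
    sfx (Trev T n) n p = (seg T 1 (n - p)).reverse ++ [T n] := by
  have hlen : n + 1 - p = (n - p) + 1 := by omega
  rw [sfx, hlen, seg_succ]
  congr 1
  · apply List.ext_getElem
    · simp [seg_length]
    · intro k h1 h2
      simp only [seg_length] at h1
      simp only [seg, List.getElem_map, List.getElem_range, List.getElem_reverse, Trev,
        List.length_map, List.length_range]
      rw [if_neg (by omega)]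
      congr 1
      omega
  · simp [Trev, show p + (n - p) = n by omega]

namespace SASetup

theorem dollar_notMem (h : SASetup n σ T dollar SA) {i : ℕ} (hi1 : 1 ≤ i) (hi : i ≤ n) :
    T n ∉ (seg T 1 (n - SA i)).reverse := by
  rw [List.mem_reverse, mem_seg]
  rintro ⟨k, hk, hTk⟩
  have := (h.hSAmem i hi1 hi).1
  exact h.hTne (1 + k) (by omega) (by omega) (hTk.trans h.hTn)

theorem seg_ne (h : SASetup n σ T dollar SA) {i j : ℕ} (hi1 : 1 ≤ i) (hi : i ≤ n) (hj1 : 1 ≤ j)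
    (hj : j ≤ n) (hij : i ≠ j) : (seg T 1 (n - SA i)).reverse ≠ (seg T 1 (n - SA j)).reverse := by
  intro he
  have he := congrArg List.length he
  simp only [List.length_reverse, seg_length] at he
  have h1 := h.hSAmem i hi1 hi
  have h2 := h.hSAmem j hj1 hj
  exact hij (h.hSAinj i j hi1 hi hj1 hj (by omega))

theorem sfx_eq (h : SASetup n σ T dollar SA) {i : ℕ} (hi1 : 1 ≤ i) (hi : i ≤ n) :
    sfx (Trev T n) n (SA i) = (seg T 1 (n - SA i)).reverse ++ [T n] :=
  sfx_Trev (h.hSAmem i hi1 hi).2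

theorem prefix_sfx_of_suffix (h : SASetup n σ T dollar SA) {i : ℕ} (hi1 : 1 ≤ i) (hi : i ≤ n)
    {s : List ℤ} (hs : s <:+ seg T 1 (n - SA i)) : s.reverse <+: sfx (Trev T n) n (SA i) := by
  rw [h.sfx_eq hi1 hi]
  exact (List.reverse_prefix.2 hs).trans (List.prefix_append _ _)

theorem suffix_of_prefix_sfx (h : SASetup n σ T dollar SA) {i j : ℕ} (hi1 : 1 ≤ i) (hi : i ≤ n)
    (hj1 : 1 ≤ j) (hj : j ≤ n) (hij : i ≠ j) {s : List ℤ}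
    (hsi : s.reverse <+: sfx (Trev T n) n (SA i)) (hsj : s.reverse <+: sfx (Trev T n) n (SA j)) :
    s <:+ seg T 1 (n - SA i) := by
  rw [h.sfx_eq hi1 hi] at hsi
  rw [h.sfx_eq hj1 hj] at hsj
  exact List.reverse_prefix.1 <|
    prefix_of_prefix_concat (h.seg_ne hi1 hi hj1 hj hij) (h.dollar_notMem hj1 hj) hsi hsj

/-- The rows whose text prefix ends with `s` form an interval of the suffix array. -/
theorem suffix_of_between (h : SASetup n σ T dollar SA) {i k j : ℕ} (hi1 : 1 ≤ i) (hik : i ≤ k)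
    (hkj : k ≤ j) (hj : j ≤ n) {s : List ℤ} (hsi : s <:+ seg T 1 (n - SA i))
    (hsj : s <:+ seg T 1 (n - SA j)) : s <:+ seg T 1 (n - SA k) := by
  rcases hik.eq_or_lt with rfl | hik
  · exact hsi
  rcases hkj.eq_or_lt with rfl | hkj
  · exact hsj
  have hpi := h.prefix_sfx_of_suffix hi1 (by omega) hsi
  have hpj := h.prefix_sfx_of_suffix (by omega) hj hsj
  exact h.suffix_of_prefix_sfx (by omega) (by omega) hi1 (by omega) hik.ne'
    (prefix_of_lex_between (h.hSAord i k hi1 hik (by omega)) (h.hSAord k j (by omega) hkj hj)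
      hpi hpj) hpi

end SASetup

namespace LCPSetup

theorem length_le_LCP (h : LCPSetup n σ T dollar SA LCP) {i : ℕ} (hi1 : 1 < i) (hi : i ≤ n)
    {s : List ℤ} (hs : s <:+ seg T 1 (n - SA (i - 1))) (hs' : s <:+ seg T 1 (n - SA i)) :
    (s.length : ℤ) ≤ LCP i := by
  rw [h.hLCP i hi1 hi, Nat.cast_le, ← List.length_reverse]
  exact length_le_lcpLen (h.prefix_sfx_of_suffix (by omega) (by omega) hs)
    (h.prefix_sfx_of_suffix (by omega) hi hs')

theorem suffix_iff_of_length_le_LCP (h : LCPSetup n σ T dollar SA LCP) {i : ℕ} (hi1 : 1 < i)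
    (hi : i ≤ n) {s : List ℤ} (hs : (s.length : ℤ) ≤ LCP i) :
    s <:+ seg T 1 (n - SA (i - 1)) ↔ s <:+ seg T 1 (n - SA i) := by
  rw [h.hLCP i hi1 hi, Nat.cast_le, ← List.length_reverse] at hs
  have hiff := prefix_iff_of_length_le_lcpLen hs
  constructor <;> intro hsuf
  · have hp := h.prefix_sfx_of_suffix (by omega) (by omega) hsuf
    exact h.suffix_of_prefix_sfx (by omega) hi (by omega) (by omega) (by omega) (hiff.1 hp) hp
  · have hp := h.prefix_sfx_of_suffix (by omega) (by omega) hsuf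
    exact h.suffix_of_prefix_sfx (by omega) (by omega) (by omega) hi (by omega) (hiff.2 hp) hp

/-- The interval `[b(x), e(x))` consists of the rows whose text prefix ends with the string
of length `LCP x` common to the rows `x - 1` and `x`. -/
theorem exists_box (h : LCPSetup n σ T dollar SA LCP) {x : ℕ} (hx1 : 1 < x) (hx : x ≤ n) :
    ∃ s : List ℤ, (s.length : ℤ) = LCP x ∧
      ∀ k, bIdx LCP x ≤ k ∧ k < eIdx LCP n x ↔ 1 ≤ k ∧ k ≤ n ∧ s <:+ seg T 1 (n - SA k) := by
  obtain ⟨hb1, hbx, hbL, hb⟩ := bIdx_spec (L := LCP) hx1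
  obtain ⟨hex, hen, heL, he⟩ := eIdx_spec (L := LCP) hx
  set a := sfx (Trev T n) n (SA (x - 1))
  set b := sfx (Trev T n) n (SA x)
  have hL : LCP x = lcpLen a b := h.hLCP x hx1 hx
  have hlen : (b.take (lcpLen a b)).length = lcpLen a b := by
    simpa using lcpLen_le_length_right a b
  have hpre : b.take (lcpLen a b) <+: b := List.take_prefix _ _
  obtain ⟨s, hs⟩ : ∃ s : List ℤ, s.reverse = b.take (lcpLen a b) :=
    ⟨(b.take (lcpLen a b)).reverse, by simp⟩
  rw [← hs] at hpre hlen
  have hsx : s <:+ seg T 1 (n - SA x) :=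
    h.suffix_of_prefix_sfx (by omega) hx (j := x - 1) (by omega) (by omega) (by omega) hpre
      ((prefix_iff_of_length_le_lcpLen hlen.le).2 hpre)
  rw [List.length_reverse] at hlen
  have hsL : (s.length : ℤ) = LCP x := by rw [hlen, hL]
  refine ⟨s, hsL, fun k => ⟨fun ⟨hbk, hke⟩ => ⟨by omega, by omega, ?_⟩,
    fun ⟨hk1, hkn, hsk⟩ => ⟨?_, ?_⟩⟩⟩
  · rcases le_total k x with hkx | hxk
    · induction hkx using Nat.decreasingInduction with
      | self => exact hsx
      | of_succ k hkx ih =>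
        have hle : (s.length : ℤ) ≤ LCP (k + 1) := by
          rcases Nat.lt_or_ge (k + 1) x with hlt | hge
          · exact hsL.trans_le (hb _ (by omega) hlt)
          · rw [hsL, show k + 1 = x by omega]
        simpa using (h.suffix_iff_of_length_le_LCP (by omega) (by omega) hle).2
          (ih (by omega) (by omega) (by omega))
    · induction k, hxk using Nat.le_induction with
      | base => exact hsx
      | succ k hxk ih =>
        have hle : (s.length : ℤ) ≤ LCP (k + 1) := hsL.trans_le (he _ (by omega) hke)
        exact (h.suffix_iff_of_length_le_LCP (by omega) (by omega) hle).1
          (by simpa using ih (by omega) (by omega) (by omega))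
  · by_contra hlt
    have := h.length_le_LCP (i := bIdx LCP x) (by omega) (by omega)
      (h.suffix_of_between hk1 (by omega) (by omega) hx hsk hsx)
      (h.suffix_of_between hk1 (by omega) (by omega) hx hsk hsx)
    omega
  · by_contra hlt
    have := h.length_le_LCP (i := eIdx LCP n x) (by omega) (by omega)
      (h.suffix_of_between (by omega) (by omega) (by omega) hkn hsx hsk)
      (h.suffix_of_between (by omega) (by omega) (by omega) hkn hsx hsk)
    omega

end LCPSetup

namespace FullSetup

theorem BWT_mem (h : FullSetup n σ T dollar SA BWT LCP w) {i : ℕ} (hi1 : 1 ≤ i) (hi : i ≤ n) :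
    1 ≤ BWT i ∧ BWT i ≤ σ := by
  have := h.hSAmem i hi1 hi
  rw [h.hBWT i hi1 hi]
  exact h.hT _ (by omega) (by omega)

theorem occursIn_concat_iff (h : FullSetup n σ T dollar SA BWT LCP w) {s : List ℤ} {c : ℤ} :
    OccursIn T n (s ++ [c]) ↔
      ∃ i, 1 ≤ i ∧ i ≤ n ∧ s <:+ seg T 1 (n - SA i) ∧ BWT i = c := by
  constructor
  · rintro ⟨i, hi1, hi, he⟩
    simp only [List.length_append, List.length_singleton] at hi he
    rw [seg_succ] at he
    obtain ⟨hs, hc⟩ := List.append_inj' he rfl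
    obtain ⟨r, hr1, hr, hSA⟩ := h.hSAsurj (n + 1 - (i + s.length)) (by omega) (by omega)
    refine ⟨r, hr1, hr, suffix_seg_iff.2 ⟨i - 1, by omega, ?_⟩, ?_⟩
    · rwa [show 1 + (i - 1) = i by omega]
    · rw [h.hBWT r hr1 hr, show n - SA r + 1 = i + s.length by omega]
      simpa using hc.symm
  · rintro ⟨r, hr1, hr, hs, hc⟩
    obtain ⟨k, hk, hs⟩ := suffix_seg_iff.1 hs
    have := h.hSAmem r hr1 hr
    refine ⟨1 + k, by omega, by simp; omega, ?_⟩
    rw [List.length_append, List.length_singleton, seg_succ, ← hs, ← hc, h.hBWT r hr1 hr, ← hk,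
      show k + s.length + 1 = 1 + k + s.length by omega]

theorem rightMax_of_ne (h : FullSetup n σ T dollar SA BWT LCP w) {s : List ℤ} {i j : ℕ}
    (hi1 : 1 ≤ i) (hi : i ≤ n) (hj1 : 1 ≤ j) (hj : j ≤ n) (hsi : s <:+ seg T 1 (n - SA i))
    (hsj : s <:+ seg T 1 (n - SA j)) (hne : BWT i ≠ BWT j) : RightMax T n σ s :=
  ⟨BWT i, BWT j, hne, (h.BWT_mem hi1 hi).1, (h.BWT_mem hi1 hi).2, (h.BWT_mem hj1 hj).1,
    (h.BWT_mem hj1 hj).2, h.occursIn_concat_iff.2 ⟨i, hi1, hi, hsi, rfl⟩,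
    h.occursIn_concat_iff.2 ⟨j, hj1, hj, hsj, rfl⟩⟩

/-- Inside the interval of a right-maximal string, every extension letter occurs at a run change. -/
theorem exists_run_change (h : FullSetup n σ T dollar SA BWT LCP w) {s : List ℤ} {c : ℤ}
    (hs : RightMax T n σ s) (hc : OccursIn T n (s ++ [c])) :
    ∃ x, 1 < x ∧ x ≤ n ∧ BWT x ≠ BWT (x - 1) ∧ (c = BWT x ∨ c = BWT (x - 1)) ∧
      s <:+ seg T 1 (n - SA (x - 1)) ∧ s <:+ seg T 1 (n - SA x) := by
  obtain ⟨i, hi1, hi, hsi, hic⟩ := h.occursIn_concat_iff.1 hc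
  obtain ⟨j, hj1, hj, hsj, hjc⟩ :
      ∃ j, 1 ≤ j ∧ j ≤ n ∧ s <:+ seg T 1 (n - SA j) ∧ BWT j ≠ c := by
    obtain ⟨a, b, hab, -, -, -, -, ha, hb⟩ := hs
    obtain ⟨j, hj1, hj, hsj, hja⟩ := h.occursIn_concat_iff.1 ha
    obtain ⟨k, hk1, hk, hsk, hkb⟩ := h.occursIn_concat_iff.1 hb
    by_cases hac : a = c
    · exact ⟨k, hk1, hk, hsk, by omega⟩
    · exact ⟨j, hj1, hj, hsj, by omega⟩
  have hij : i ≠ j := by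
    rintro rfl
    exact hjc hic
  rcases hij.lt_or_gt with hij | hij
  · obtain ⟨x, hx1, hx, hxc, hxc'⟩ :=
      exists_adjacent_change (f := fun k => BWT k = c) hij hic hjc
    exact ⟨x, by omega, by omega, by omega, by omega,
      h.suffix_of_between hi1 (by omega) (by omega) hj hsi hsj,
      h.suffix_of_between hi1 (by omega) (by omega) hj hsi hsj⟩
  · obtain ⟨x, hx1, hx, hxc, hxc'⟩ :=
      exists_adjacent_change (f := fun k => BWT k ≠ c) hij hjc (by simpa using hic)
    exact ⟨x, by omega, by omega, by omega, by omega,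
      h.suffix_of_between hj1 (by omega) (by omega) hi hsj hsi,
      h.suffix_of_between hj1 (by omega) (by omega) hi hsj hsi⟩

theorem rightMax_nil (h : FullSetup n σ T dollar SA BWT LCP w) : RightMax T n σ [] := by
  have hn := h.hn
  refine ⟨T 1, T n, by rw [h.hTn]; exact h.hTne 1 le_rfl hn, (h.hT 1 le_rfl (by omega)).1,
    (h.hT 1 le_rfl (by omega)).2, (h.hT n (by omega) le_rfl).1, (h.hT n (by omega) le_rfl).2,
    ⟨1, le_rfl, by simp; omega, by simp [seg]⟩, ⟨n, by omega, by simp, by simp [seg]⟩⟩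

theorem isGreatest_w (h : FullSetup n σ T dollar SA BWT LCP w) {x : ℕ} (hx1 : 1 ≤ x) (hx : x ≤ n)
    (hrb : RunBoundary BWT n x) :
    IsGreatest {m : ℤ | ∃ s : List ℤ, RightMax T n σ s ∧ s <:+ seg T 1 (n - SA x) ∧
      m = (s.length : ℤ)} (w x) :=
  h.hwRB x hx1 hx hrb ⟨[], h.rightMax_nil, List.nil_suffix⟩

theorem length_le_w (h : FullSetup n σ T dollar SA BWT LCP w) {x : ℕ} (hx1 : 1 ≤ x) (hx : x ≤ n)
    (hrb : RunBoundary BWT n x) {s : List ℤ} (hs : RightMax T n σ s)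
    (hsx : s <:+ seg T 1 (n - SA x)) : (s.length : ℤ) ≤ w x :=
  (h.isGreatest_w hx1 hx hrb).2 ⟨s, hs, hsx, rfl⟩

theorem runBoundary_of_w_nonneg (h : FullSetup n σ T dollar SA BWT LCP w) {x : ℕ} (hx1 : 1 ≤ x)
    (hx : x ≤ n) (hw : 0 ≤ w x) : RunBoundary BWT n x := by
  by_contra hrb
  have := h.hwNot x hx1 hx hrb
  omega

/-- Like `exists_run_change`, but selecting the boundary row that carries the letter `c`. -/
theorem exists_le_w (h : FullSetup n σ T dollar SA BWT LCP w) {s : List ℤ} {c : ℤ}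
    (hs : RightMax T n σ s) (hc : OccursIn T n (s ++ [c])) :
    ∃ x y, 1 < x ∧ x ≤ n ∧ BWT x ≠ BWT (x - 1) ∧ (c = BWT x ∨ c = BWT (x - 1)) ∧
      s <:+ seg T 1 (n - SA (x - 1)) ∧ s <:+ seg T 1 (n - SA x) ∧
      (y = x ∨ y = x - 1) ∧ BWT y = c ∧ (s.length : ℤ) ≤ w y := by
  obtain ⟨x, hx1, hx, hne, hcx, hs1, hs2⟩ := h.exists_run_change hs hc
  rcases id hcx with rfl | rfl
  · exact ⟨x, x, hx1, hx, hne, hcx, hs1, hs2, Or.inl rfl, rfl,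
      h.length_le_w (by omega) hx (Or.inl ⟨hx1, hne⟩) hs hs2⟩
  · exact ⟨x, x - 1, hx1, hx, hne, hcx, hs1, hs2, Or.inr rfl, rfl,
      h.length_le_w (by omega) (by omega)
        (Or.inr ⟨by omega, by rw [Nat.sub_add_cancel (by omega)]; exact hne.symm⟩) hs hs1⟩

theorem concat_suffix_iff (h : FullSetup n σ T dollar SA BWT LCP w) {i : ℕ} (hi1 : 1 ≤ i)
    (hi : i ≤ n) {s : List ℤ} {c : ℤ} :
    s ++ [c] <:+ seg T 1 (n - SA i + 1) ↔ s <:+ seg T 1 (n - SA i) ∧ c = BWT i := by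
  rw [seg_succ, concat_suffix_concat_iff, h.hBWT i hi1 hi, add_comm 1]

theorem suffixient_FullL (h : FullSetup n σ T dollar SA BWT LCP w) :
    Suffixient T n σ (FullL n SA BWT LCP w) := by
  intro s hs c _ _ hc
  obtain ⟨x, y, hx1, hx, hne, hcx, hs1, hs2, hyx, hyc, hwy⟩ := h.exists_le_w hs hc
  obtain ⟨t, ht, hbox⟩ := h.exists_box hx1 hx
  obtain ⟨hb1, hbx, -, -⟩ := bIdx_spec (L := LCP) hx1
  obtain ⟨hex, -, -, -⟩ := eIdx_spec (L := LCP) hx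
  obtain ⟨p, hp⟩ := exists_eq_candt (BWT := BWT) (w := w) (c := c) (a := bIdx LCP x)
    (a' := eIdx LCP n x) (q := y) (by omega) (by omega) hyc (by omega)
  refine ⟨n - SA p + 1, ⟨x, hx1, hx, hne, c, hcx, p, hp, rfl⟩, ?_⟩
  obtain ⟨hbp, hpe, hpc, -, -⟩ := candt_spec hp
  obtain ⟨hp1, hpn, htp⟩ := (hbox p).1 ⟨hbp, hpe⟩
  rw [h.concat_suffix_iff hp1 hpn]
  have hst : s <:+ t := List.suffix_of_suffix_length_le hs2
    ((hbox x).1 ⟨by omega, by omega⟩).2.2 (by have := h.length_le_LCP hx1 hx hs1 hs2; omega)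
  exact ⟨hst.trans htp, hpc.symm⟩

/-- Each element of `FullL` arises from a row `p` representing a supermaximal right extension
`u ++ [c]`, and is the first row of maximal weight representing it. -/
theorem exists_supermaximal (h : FullSetup n σ T dollar SA BWT LCP w) {q : ℕ}
    (hq : q ∈ FullL n SA BWT LCP w) :
    ∃ (u : List ℤ) (c : ℤ), RightMax T n σ u ∧ OccursIn T n (u ++ [c]) ∧ 1 ≤ c ∧ c ≤ σ ∧
      (∀ v, RightMax T n σ v → OccursIn T n (v ++ [c]) → u <:+ v → v = u) ∧
      ∃ (p : ℕ) (s : List ℤ), q = n - SA p + 1 ∧ 1 ≤ p ∧ p ≤ n ∧ BWT p = c ∧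
        w p = u.length ∧ u <:+ seg T 1 (n - SA p) ∧ s <:+ u ∧
        ∀ k, 1 ≤ k → k ≤ n → s <:+ seg T 1 (n - SA k) → BWT k = c → w k = w p → p ≤ k := by
  obtain ⟨x, hx1, hx, hne, c, hcx, p, hp, rfl⟩ := hq
  obtain ⟨s, hs, hbox⟩ := h.exists_box hx1 hx
  obtain ⟨hbp, hpe, hpc, hwp, hmax⟩ := candt_spec hp
  obtain ⟨hp1, hpn, hsp⟩ := (hbox p).1 ⟨hbp, hpe⟩
  obtain ⟨-, hbx, -, -⟩ := bIdx_spec (L := LCP) hx1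
  obtain ⟨hex, -, -, -⟩ := eIdx_spec (L := LCP) hx
  have hrb := h.runBoundary_of_w_nonneg hp1 hpn hwp
  obtain ⟨u, hu, hup, hwu⟩ := (h.isGreatest_w hp1 hpn hrb).1
  have hsR : RightMax T n σ s := h.rightMax_of_ne (i := x) (j := x - 1) (by omega) hx (by omega)
    (by omega) ((hbox x).1 ⟨by omega, by omega⟩).2.2
    ((hbox (x - 1)).1 ⟨by omega, by omega⟩).2.2 hne
  have hsu : s <:+ u := List.suffix_of_suffix_length_le hsp hup
    (by have := h.length_le_w hp1 hpn hrb hsR hsp; omega)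
  have hc := h.BWT_mem hp1 hpn
  rw [hpc] at hc
  refine ⟨u, c, hu, h.occursIn_concat_iff.2 ⟨p, hp1, hpn, hup, hpc⟩, hc.1, hc.2, ?_,
    p, s, rfl, hp1, hpn, hpc, hwu, hup, hsu, fun k hk1 hk hsk hkc hwk => ?_⟩
  · intro v hv hvc huv
    obtain ⟨z, y, hz1, hz, -, -, hvz1, hvz2, hyz, hyc, hwy⟩ := h.exists_le_w hv hvc
    have hvy : v <:+ seg T 1 (n - SA y) := by rcases hyz with rfl | rfl <;> assumption
    obtain ⟨hby, hye⟩ := (hbox y).2 ⟨by omega, by omega, (hsu.trans huv).trans hvy⟩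
    have := (hmax y hby hye hyc).1
    have := huv.length_le
    exact (huv.eq_of_length (by omega)).symm
  · obtain ⟨hbk, hke⟩ := (hbox k).2 ⟨hk1, hk, hsk⟩
    exact (hmax k hbk hke hkc).2 hwk

theorem ncard_FullL_le (h : FullSetup n σ T dollar SA BWT LCP w) {F : Set ℕ} (hF : F.Finite)
    (hsuf : Suffixient T n σ F) : (FullL n SA BWT LCP w).ncard ≤ F.ncard := by
  choose! u c hu huc hc1 hcσ hmax p s hqp hp1 hpn hpc hwp hup hsu hfirst using
    fun q (hq : q ∈ FullL n SA BWT LCP w) => h.exists_supermaximal hq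
  choose! g hgF hg using fun q (hq : q ∈ FullL n SA BWT LCP w) =>
    hsuf (u q) (hu q hq) (c q) (hc1 q hq) (hcσ q hq) (huc q hq)
  refine Set.ncard_le_ncard_of_injOn g hgF ?_ hF
  have key : ∀ q ∈ FullL n SA BWT LCP w, ∀ q' ∈ FullL n SA BWT LCP w, g q = g q' →
      (u q).length ≤ (u q').length → c q = c q' ∧ u q = u q' := by
    intro q hq q' hq' hgg hle
    have hsub : u q ++ [c q] <:+ u q' ++ [c q'] :=
      List.suffix_of_suffix_length_le (hg q hq) (hgg ▸ hg q' hq') (by simpa using hle)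
    obtain ⟨hsub, hcc⟩ := concat_suffix_concat_iff.1 hsub
    exact ⟨hcc, (hmax q hq _ (hu q' hq') (hcc ▸ huc q' hq') hsub).symm⟩
  intro q hq q' hq' hgg
  obtain ⟨hcc, huu⟩ : c q = c q' ∧ u q = u q' := by
    rcases le_total (u q).length (u q').length with hle | hle
    · exact key q hq q' hq' hgg hle
    · exact (key q' hq' q hq hgg.symm hle).imp Eq.symm Eq.symm
  have hww : w (p q) = w (p q') := by rw [hwp q hq, hwp q' hq', huu]
  have h1 : p q ≤ p q' := hfirst q hq _ (hp1 q' hq') (hpn q' hq')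
    ((hsu q hq).trans (huu ▸ hup q' hq')) ((hpc q' hq').trans hcc.symm) hww.symm
  have h2 : p q' ≤ p q := hfirst q' hq' _ (hp1 q hq) (hpn q hq)
    ((hsu q' hq').trans (huu ▸ hup q hq)) ((hpc q hq).trans hcc) hww
  rw [hqp q hq, hqp q' hq', le_antisymm h1 h2]

end FullSetup

end SuffixArray

/-- `FullL` is a minimum-size suffixient set for `T`: it is suffixient, and every
suffixient set `F ⊆ {1,…,n}` satisfies `|F| ≥ |FullL|`. -/
theorem stmt8 (n σ : ℕ) (T : ℕ → ℤ) (dollar : ℤ) (SA : ℕ → ℕ) (BWT LCP w : ℕ → ℤ)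
    (hsetup : FullSetup n σ T dollar SA BWT LCP w) :
    Suffixient T n σ (FullL n SA BWT LCP w) ∧
      ∀ F : Set ℕ, F ⊆ Set.Icc 1 n → Suffixient T n σ F →
        (FullL n SA BWT LCP w).ncard ≤ F.ncard := by
  exact ⟨hsetup.suffixient_FullL, fun F hF hsuf =>
    hsetup.ncard_FullL_le ((Set.finite_Icc 1 n).subset hF) hsuf⟩
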